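/- For all integers m ≥ k ≥ 4, ESO(m,k) ≥ ⌊k/2⌋·(m−k+5) − 3. Equivalently, player B has a strategy in the game A_{m,k} guaranteeing that, for every strategy of player A, among the first ⌊k/2⌋·(m−k+5) − 4 points played there is neither an m-up-run nor a k-down-run. -/

import Mathlib

open Set

/-- A point in the plane. -/
abbrev Pt : Type := ℝ × ℝ

/-- The point set `P` contains an `n`-up-run: `n` points with strictly increasing
`x`-coordinates and nondecreasing `y`-coordinates. -/
def HasUpRun (P : Set Pt) (n : ℕ) : Prop :=
  ∃ f : Fin n → Pt, (∀ i, f i ∈ P) ∧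
    StrictMono (fun i => (f i).1) ∧ Monotone (fun i => (f i).2)

/-- The point set `P` contains an `n`-down-run: `n` points with strictly increasing
`x`-coordinates and strictly decreasing `y`-coordinates. -/
def HasDownRun (P : Set Pt) (n : ℕ) : Prop :=
  ∃ f : Fin n → Pt, (∀ i, f i ∈ P) ∧
    StrictMono (fun i => (f i).1) ∧ StrictAnti (fun i => (f i).2)

/-- A strategy for player A: from the list of previously played points, choose
an x-coordinate. -/
abbrev AStrat : Type := List Pt → ℝ

/-- A strategy for player B: from the list of previously played points and the new
x-coordinate, choose a y-coordinate. -/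
abbrev BStrat : Type := List Pt → ℝ → ℝ

/-- Validity of a strategy for player A in either game: the chosen x-coordinate lies in
`(0,1)` and is distinct from all previously played x-coordinates. -/
def AValid (sA : AStrat) : Prop :=
  ∀ h : List Pt, sA h ∈ Ioo (0:ℝ) 1 ∧ ∀ p ∈ h, sA h ≠ p.1

/-- Validity of a strategy for player B in the game `A_{m,k}`: the chosen y-coordinate
lies in `(0,1)` and is distinct from all previously played y-coordinates. -/
def BValid (sB : BStrat) : Prop :=
  ∀ (h : List Pt) (x : ℝ), sB h x ∈ Ioo (0:ℝ) 1 ∧ ∀ p ∈ h, sB h x ≠ p.2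

/-- The list of points played in the first `n` turns when A plays `sA` and B plays `sB`. -/
def hist (sA : AStrat) (sB : BStrat) : ℕ → List Pt
  | 0 => []
  | n + 1 =>
      let h := hist sA sB n
      h ++ [(sA h, sB h (sA h))]

/-- The set of points played in the first `N` turns. -/
def played (sA : AStrat) (sB : BStrat) (N : ℕ) : Set Pt :=
  {p | p ∈ hist sA sB N}

/-- In the game `A_{m,k}`, strategy `sA` of player A is valid and guarantees an
`m`-up-run or a `k`-down-run among the first `N` points, against every valid
strategy of player B. -/
def AWinsBy (m k N : ℕ) (sA : AStrat) : Prop :=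
  AValid sA ∧ ∀ sB : BStrat, BValid sB →
    HasUpRun (played sA sB N) m ∨ HasDownRun (played sA sB N) k

/-- The Erdős–Szekeres on-line number `ESO(m,k)`: the least `N` such that player A
has a strategy forcing an `m`-up-run or a `k`-down-run within `N` turns. -/
noncomputable def ESO (m k : ℕ) : ℕ := sInf {N | ∃ sA : AStrat, AWinsBy m k N sA}

/-- Validity of a strategy for player B in the tier game `B_{m,k}`: the chosen
y-coordinate is an integer in `{1, …, k-1}` (repetitions allowed). -/
def BTierValid (k : ℕ) (sB : BStrat) : Prop :=
  ∀ (h : List Pt) (x : ℝ), ∃ j : ℕ, 1 ≤ j ∧ j ≤ k - 1 ∧ sB h x = (j : ℝ)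

/-- In the tier game `B_{m,k}`, strategy `sA` of player A is valid and guarantees an
`m`-up-run among the first `N` points, against every valid strategy of player B. -/
def AWinsTierBy (m k N : ℕ) (sA : AStrat) : Prop :=
  AValid sA ∧ ∀ sB : BStrat, BTierValid k sB → HasUpRun (played sA sB N) m

/-- `B(m,k)`: the least `N` such that player A has a strategy forcing an `m`-up-run
within `N` turns of the tier game `B_{m,k}`. -/
noncomputable def BNum (m k : ℕ) : ℕ := sInf {N | ∃ sA : AStrat, AWinsTierBy m k N sA}

/-- The subword of `w` formed by the inner letters `1, …, q`. -/
def innerWord (q : ℕ) (w : List ℕ) : List ℕ := w.filter (fun c => decide (1 ≤ c ∧ c ≤ q))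

/-- Nondecreasing subsequences of the factors of `W` are bounded by `M`, with a saving that
depends on the lengths of the prefix and the suffix outside the factor. -/
def WindowBound (M : ℕ) (l r : ℕ → ℕ) (W : List ℕ) : Prop :=
  ∀ A Z C s : List ℕ, W = A ++ Z ++ C → s.Sublist Z → s.Pairwise (· ≤ ·) → s ≠ [] →
    s.length + l A.length + r C.length ≤ M

/-- The savings `l` and `r` in the window bound are monotone and jointly at least `P` at each
cut of a word of length `n`. -/
structure Savings (P n : ℕ) (l r : ℕ → ℕ) : Prop where
  mono_left : Monotone l
  mono_right : Monotone r
  le_cut : ∀ i j, i + j = n → P ≤ l i + r j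

/-- A word over `0, …, q + 1` whose inner word has length `n` and the window bound, in which the
occurrences of the outer letters `0` and `q + 1` are controlled by the savings. -/
def OuterGood (q n M P : ℕ) (w : List ℕ) : Prop :=
  (∀ c ∈ w, c ≤ q + 1) ∧ ∃ l r : ℕ → ℕ, Savings P (innerWord q w).length l r ∧
    WindowBound M l r (innerWord q w) ∧ (innerWord q w).length = n ∧
    ∀ u v, w = u ++ v → u.count 0 ≤ l (innerWord q u).length ∧
      v.count (q + 1) ≤ r (innerWord q v).length

lemma innerWord_append (q : ℕ) (u v : List ℕ) :
    innerWord q (u ++ v) = innerWord q u ++ innerWord q v := by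
  simp [innerWord]

lemma innerWord_cons_zero (q : ℕ) (v : List ℕ) : innerWord q (0 :: v) = innerWord q v := by
  simp [innerWord]

lemma innerWord_cons_top (q : ℕ) (v : List ℕ) :
    innerWord q ((q + 1) :: v) = innerWord q v := by
  simp [innerWord]

lemma innerWord_eq_self {q : ℕ} {w : List ℕ} (h : ∀ c ∈ w, 1 ≤ c ∧ c ≤ q) :
    innerWord q w = w := by
  simpa [innerWord] using h

lemma count_add_count_add_length_innerWord {q : ℕ} {w : List ℕ} (h : ∀ c ∈ w, c ≤ q + 1) :
    w.count 0 + w.count (q + 1) + (innerWord q w).length = w.length := by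
  induction w with
  | nil => simp [innerWord]
  | cons a w ih =>
    have ih := ih fun c hc => h c (List.mem_cons_of_mem _ hc)
    have ha := h a List.mem_cons_self
    rcases Nat.eq_zero_or_pos a with rfl | h0
    · rw [innerWord_cons_zero]
      simp
      omega
    rcases ha.eq_or_lt with rfl | h1
    · rw [innerWord_cons_top]
      simp
      omega
    · have : innerWord q (a :: w) = a :: innerWord q w := by
        simp [innerWord, show 1 ≤ a by omega, show a ≤ q by omega]
      rw [this, List.count_cons_of_ne (by omega), List.count_cons_of_ne (by omega)]
      simp
      omega

lemma OuterGood.of_inner {q M P : ℕ} {w : List ℕ} (hw : ∀ c ∈ w, 1 ≤ c ∧ c ≤ q)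
    (h : ∃ l r, Savings P w.length l r ∧ WindowBound M l r w) :
    OuterGood q w.length M P w := by
  obtain ⟨l, r, hs, hb⟩ := h
  refine ⟨fun c hc => by have := hw c hc; omega, l, r, ?_, ?_, ?_, ?_⟩ <;>
    try rw [innerWord_eq_self hw]
  · exact hs
  · exact hb
  · rintro u v rfl
    constructor
    · rw [List.count_eq_zero_of_not_mem]
      · omega
      · intro h
        have := hw 0 (List.mem_append_left _ h)
        omega
    · rw [List.count_eq_zero_of_not_mem]
      · omega
      · intro h
        have := hw (q + 1) (List.mem_append_right _ h)
        omega

/-- A sorted word splits into its zeros, its inner letters and its top letters. -/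
lemma exists_split_of_sorted {q : ℕ} {s : List ℕ} (hs : s.Pairwise (· ≤ ·))
    (hq : ∀ c ∈ s, c ≤ q + 1) :
    ∃ a s' b, s = List.replicate a 0 ++ s' ++ List.replicate b (q + 1) ∧
      ∀ c ∈ s', 1 ≤ c ∧ c ≤ q := by
  induction s with
  | nil => exact ⟨0, [], 0, by simp, by simp⟩
  | cons x s ih =>
    rw [List.pairwise_cons] at hs
    obtain ⟨a, s', b, rfl, h'⟩ := ih hs.2 fun c hc => hq c (List.mem_cons_of_mem _ hc)
    have hx := hq x List.mem_cons_self
    rcases Nat.eq_zero_or_pos x with rfl | h0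
    · exact ⟨a + 1, s', b, by simp [List.replicate_succ], h'⟩
    have ha : a = 0 := by
      by_contra ha
      have := hs.1 0 (by simp [ha])
      omega
    subst ha
    rcases hx.eq_or_lt with rfl | h1
    · have : s' = [] := by
        rw [List.eq_nil_iff_forall_not_mem]
        intro c hc
        have := hs.1 c (by simp [hc])
        have := h' c hc
        omega
      subst this
      exact ⟨0, [], b + 1, by simp [List.replicate_succ], by simp⟩
    · refine ⟨0, x :: s', b, by simp, ?_⟩
      simp only [List.mem_cons, forall_eq_or_imp]
      exact ⟨by omega, h'⟩

lemma OuterGood.length_le {q n M P : ℕ} {w s : List ℕ} (h : OuterGood q n M P w)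
    (hPM : P ≤ M) (hw : w.length ≤ n + P) (hsw : s.Sublist w) (hs : s.Pairwise (· ≤ ·)) :
    s.length ≤ M := by
  obtain ⟨hq, l, r, -, hb, hn, hc⟩ := h
  have htot := count_add_count_add_length_innerWord hq
  obtain ⟨a, s', b, rfl, hs'⟩ := exists_split_of_sorted hs fun c hc => hq c (hsw.subset hc)
  obtain ⟨y, v, rfl, hy, hv⟩ := List.append_sublist_iff.1 hsw
  obtain ⟨u, z, rfl, hu, hz⟩ := List.append_sublist_iff.1 hy
  have ha : a ≤ u.count 0 := by
    simpa using hu.count_le 0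
  have hb' : b ≤ v.count (q + 1) := by
    simpa using hv.count_le (q + 1)
  have h1 := (hc u (z ++ v) (by simp)).1
  have h2 := (hc (u ++ z) v (by simp)).2
  by_cases hnil : s' = []
  · subst hnil
    simp only [List.count_append] at htot
    simp only [List.append_nil, List.length_append, List.length_replicate] at *
    omega
  · have hz' : s'.Sublist (innerWord q z) := by
      have := hz.filter (fun c => decide (1 ≤ c ∧ c ≤ q))
      rwa [List.filter_eq_self.2 (by simpa using hs')] at this
    have h3 := hb (innerWord q u) (innerWord q z) (innerWord q v) s'
      (by simp [innerWord_append]) hz'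
      ((List.pairwise_append.1 (List.pairwise_append.1 hs).1).2.1) hnil
    simp only [List.length_append, List.length_replicate]
    omega

lemma OuterGood.exists_insert {q n M P : ℕ} {u v : List ℕ} (h : OuterGood q n M P (u ++ v))
    (hw : (u ++ v).length < n + P) :
    ∃ c ≤ q + 1, OuterGood q n M P (u ++ c :: v) := by
  obtain ⟨hq, l, r, hs, hb, hn, hc⟩ := h
  have htot := count_add_count_add_length_innerWord hq
  by_contra! hno
  have key : ∀ c ≤ q + 1, innerWord q (c :: v) = innerWord q v →
      ∃ u' v', u ++ c :: v = u' ++ v' ∧ ¬ (u'.count 0 ≤ l (innerWord q u').length ∧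
        v'.count (q + 1) ≤ r (innerWord q v').length) := by
    intro c hcq hcv
    by_contra! hcon
    have heq : innerWord q (u ++ c :: v) = innerWord q (u ++ v) := by
      rw [innerWord_append, hcv, innerWord_append]
    refine hno c hcq ⟨?_, l, r, by rwa [heq], by rwa [heq], by rwa [heq], hcon⟩
    intro d hd
    simp only [List.mem_append, List.mem_cons] at hd hq
    rcases hd with hd | rfl | hd
    · exact hq d (Or.inl hd)
    · exact hcq
    · exact hq d (Or.inr hd)
  obtain ⟨x₁, y₁, e₁, n₁⟩ := key 0 (by omega) (innerWord_cons_zero q v)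
  obtain ⟨x₂, y₂, e₂, n₂⟩ := key (q + 1) le_rfl (innerWord_cons_top q v)
  have hL : ∃ v₁ v₂, v = v₁ ++ v₂ ∧ l (innerWord q (u ++ v₁)).length ≤ (u ++ v₁).count 0 := by
    rcases List.append_eq_append_iff.1 e₁ with ⟨z, rfl, hz⟩ | ⟨z, rfl, rfl⟩
    · cases z with
      | nil =>
        simp only [List.nil_append] at hz
        subst hz
        exfalso
        apply n₁
        have := hc u v rfl
        rw [innerWord_cons_zero, List.append_nil, List.count_cons_of_ne (by omega)]
        exact this
      | cons d z =>
        simp only [List.cons_append, List.cons.injEq] at hz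
        obtain ⟨rfl, rfl⟩ := hz
        refine ⟨z, y₁, rfl, ?_⟩
        have := hc (u ++ z) y₁ (by simp)
        rw [innerWord_append, innerWord_cons_zero, ← innerWord_append] at n₁
        simp only [List.count_append, List.count_cons_self] at n₁ this ⊢
        omega
    · exfalso
      apply n₁
      have := hc x₁ (z ++ v) (by simp)
      rw [innerWord_append, innerWord_cons_zero, ← innerWord_append]
      simpa using this
  have hR : ∃ u₁ u₂, u = u₁ ++ u₂ ∧
      r (innerWord q (u₂ ++ v)).length ≤ (u₂ ++ v).count (q + 1) := by
    rcases List.append_eq_append_iff.1 e₂ with ⟨z, rfl, hz⟩ | ⟨z, rfl, rfl⟩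
    · cases z with
      | nil =>
        simp only [List.nil_append] at hz
        subst hz
        refine ⟨u, [], by simp, ?_⟩
        have := hc u v rfl
        rw [innerWord_cons_top] at n₂
        simp only [List.append_nil, List.nil_append, List.count_cons_self] at n₂ ⊢
        omega
      | cons d z =>
        simp only [List.cons_append, List.cons.injEq] at hz
        obtain ⟨rfl, rfl⟩ := hz
        exfalso
        apply n₂
        have := hc (u ++ z) y₂ (by simp)
        rw [innerWord_append, innerWord_cons_top, ← innerWord_append]
        simpa using this
    · refine ⟨x₂, z, rfl, ?_⟩
      have := hc x₂ (z ++ v) (by simp)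
      rw [innerWord_append, innerWord_cons_top, ← innerWord_append] at n₂
      simp only [List.count_append, List.count_cons_self] at n₂ this ⊢
      omega
  obtain ⟨v₁, v₂, rfl, hL⟩ := hL
  obtain ⟨u₁, u₂, rfl, hR⟩ := hR
  have hcut := hs.le_cut (innerWord q (u₁ ++ u₂)).length (innerWord q (v₁ ++ v₂)).length
    (by rw [innerWord_append q (u₁ ++ u₂), List.length_append])
  have m₁ : l (innerWord q (u₁ ++ u₂)).length ≤ l (innerWord q (u₁ ++ u₂ ++ v₁)).length :=
    hs.mono_left (by rw [innerWord_append q (u₁ ++ u₂), List.length_append]; omega)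
  have m₂ : r (innerWord q (v₁ ++ v₂)).length ≤ r (innerWord q (u₂ ++ (v₁ ++ v₂))).length :=
    hs.mono_right (by rw [innerWord_append q u₂, List.length_append]; omega)
  simp only [List.count_append] at htot hL hR
  omega

/-- A property of words over `0, …, K - 1` that survives one insertion at any place as long as
the word is shorter than `N`, and that forces nondecreasing subsequences to be of length at most
`M` in words of length at most `N`. -/
structure TierInvariant (K N M : ℕ) (Good : List ℕ → Prop) : Prop where
  nil : Good []
  exists_insert : ∀ u v, Good (u ++ v) → (u ++ v).length < N → ∃ c < K, Good (u ++ c :: v)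
  length_le : ∀ w s : List ℕ, Good w → w.length ≤ N → s.Sublist w → s.Pairwise (· ≤ ·) →
    s.length ≤ M

/-- An invariant for words over `1, …, q` extends to more moves by means of two outer letters. -/
lemma exists_tierInvariant_of_inner {q n M P : ℕ} (hPM : P ≤ M) (G : List ℕ → Prop)
    (hnil : G []) (hG : ∀ w, G w → ∀ c ∈ w, 1 ≤ c ∧ c ≤ q)
    (hins : ∀ u v, G (u ++ v) → (u ++ v).length < n → ∃ c, G (u ++ c :: v))
    (hready : ∀ w, G w → w.length ≤ n → ∃ l r, Savings P w.length l r ∧ WindowBound M l r w) :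
    ∃ Good, TierInvariant (q + 2) (n + P) M Good := by
  refine ⟨fun w => (G w ∧ w.length ≤ n) ∨ OuterGood q n M P w,
    Or.inl ⟨hnil, by simp⟩, ?_, ?_⟩
  · have outer : ∀ u v, OuterGood q n M P (u ++ v) → (u ++ v).length < n + P →
        ∃ c < q + 2, (G (u ++ c :: v) ∧ (u ++ c :: v).length ≤ n) ∨
          OuterGood q n M P (u ++ c :: v) := by
      intro u v h hlt
      obtain ⟨c, hc, h'⟩ := h.exists_insert hlt
      exact ⟨c, by omega, Or.inr h'⟩
    rintro u v (⟨h, hle⟩ | h) hlt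
    · rcases hle.eq_or_lt with heq | hlt'
      · refine outer u v ?_ hlt
        have := OuterGood.of_inner (hG _ h) (hready _ h hle)
        rwa [heq] at this
      · obtain ⟨c, hc⟩ := hins u v h hlt'
        refine ⟨c, ?_, Or.inl ⟨hc, ?_⟩⟩
        · have := hG _ hc c (by simp)
          omega
        · simp only [List.length_append, List.length_cons] at hlt' ⊢
          omega
    · exact outer u v h hlt
  · rintro w s (⟨h, hle⟩ | h) hlen hsub hs
    · exact (OuterGood.of_inner (hG _ h) (hready _ h hle)).length_le hPM (by omega) hsub hs
    · exact h.length_le hPM hlen hsub hs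

/-- The invariant for three tiers: all inner letters coincide. -/
lemma exists_tierInvariant_three (M : ℕ) : ∃ Good, TierInvariant 3 (M + M) M Good := by
  refine exists_tierInvariant_of_inner (q := 1) le_rfl (fun w => ∀ c ∈ w, c = 1) (by simp)
    (fun w hw c hc => by simp [hw c hc]) ?_ ?_
  · intro u v h _
    refine ⟨1, fun c hc => ?_⟩
    simp only [List.mem_append, List.mem_cons] at h hc
    rcases hc with hc | rfl | hc
    · exact h c (Or.inl hc)
    · rfl
    · exact h c (Or.inr hc)
  · intro w _ hlen
    refine ⟨fun i => i + (M - w.length), id, ⟨fun i j h => by simpa using h, monotone_id, ?_⟩, ?_⟩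
    · intro i j h
      simp only [id]
      omega
    · rintro A Z C s rfl hsub - -
      have := hsub.length_le
      simp only [List.length_append, id] at *
      omega

/-- A word with distinct letters, all in the interval from `lo` to `hi`. -/
def IsBlock (lo hi : ℕ) (b : List ℕ) : Prop := b.Nodup ∧ ∀ c ∈ b, lo ≤ c ∧ c ≤ hi

lemma IsBlock.mono {lo hi lo' hi' : ℕ} {b : List ℕ} (h : IsBlock lo hi b) (h₁ : lo' ≤ lo)
    (h₂ : hi ≤ hi') : IsBlock lo' hi' b :=
  ⟨h.1, fun c hc => ⟨h₁.trans (h.2 c hc).1, (h.2 c hc).2.trans h₂⟩⟩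

lemma IsBlock.sublist {lo hi : ℕ} {a b : List ℕ} (h : IsBlock lo hi b) (hab : a.Sublist b) :
    IsBlock lo hi a :=
  ⟨h.1.sublist hab, fun c hc => h.2 c (hab.subset hc)⟩

lemma IsBlock.length_le {lo hi : ℕ} {b : List ℕ} (h : IsBlock lo hi b) :
    b.length ≤ hi + 1 - lo := by
  rw [← Nat.card_Icc, ← List.toFinset_card_of_nodup h.1]
  exact Finset.card_le_card fun c hc => Finset.mem_Icc.2 (h.2 c (List.mem_toFinset.1 hc))

lemma IsBlock.exists_insert {lo hi : ℕ} {u v : List ℕ} (h : IsBlock lo hi (u ++ v))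
    (hlt : (u ++ v).length < hi + 1 - lo) : ∃ c, IsBlock lo hi (u ++ c :: v) := by
  have hcard : (u ++ v).toFinset.card < (Finset.Icc lo hi).card := by
    rw [Nat.card_Icc]
    exact (List.toFinset_card_le _).trans_lt hlt
  obtain ⟨c, hc, hcn⟩ := Finset.exists_mem_notMem_of_card_lt_card hcard
  rw [Finset.mem_Icc] at hc
  rw [List.mem_toFinset] at hcn
  have hperm : (u ++ c :: v).Perm (c :: (u ++ v)) := List.perm_middle
  refine ⟨c, hperm.nodup_iff.2 (List.nodup_cons.2 ⟨hcn, h.1⟩), fun d hd => ?_⟩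
  rcases List.mem_cons.1 (hperm.mem_iff.1 hd) with rfl | hd
  · exact hc
  · exact h.2 d hd

/-- An overflowing block splits into two blocks of prescribed sizes. -/
lemma IsBlock.exists_split {lo hi lo₁ hi₁ lo₂ hi₂ s₁ s₂ : ℕ} {u v : List ℕ}
    (h : IsBlock lo hi (u ++ v)) (hlen : (u ++ v).length + 1 = s₁ + s₂)
    (h₁ : lo₁ ≤ lo) (h₁' : hi ≤ hi₁) (h₂ : lo₂ ≤ lo) (h₂' : hi ≤ hi₂)
    (hs₁ : s₁ ≤ hi₁ + 1 - lo₁) (hs₂ : s₂ ≤ hi₂ + 1 - lo₂) :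
    ∃ c y z, u ++ c :: v = y ++ z ∧ IsBlock lo₁ hi₁ y ∧ IsBlock lo₂ hi₂ z ∧
      y.length = s₁ ∧ z.length = s₂ := by
  rw [List.length_append] at hlen
  rcases lt_or_ge u.length s₁ with hu | hu
  · have hblk : IsBlock lo₁ hi₁ (u ++ v.take (s₁ - 1 - u.length)) :=
      (h.mono h₁ h₁').sublist (List.Sublist.append_left (List.take_sublist _ _) _)
    obtain ⟨c, hc⟩ := hblk.exists_insert (by simp; omega)
    refine ⟨c, u ++ c :: v.take (s₁ - 1 - u.length), v.drop (s₁ - 1 - u.length), ?_, hc, ?_, ?_, ?_⟩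
    · simp
    · exact (h.mono h₂ h₂').sublist ((List.drop_sublist _ _).trans (List.sublist_append_right _ _))
    · simp
      omega
    · simp
      omega
  · have hblk : IsBlock lo₂ hi₂ (u.drop s₁ ++ v) :=
      (h.mono h₂ h₂').sublist (List.Sublist.append_right (List.drop_sublist _ _) _)
    obtain ⟨c, hc⟩ := hblk.exists_insert (by simp; omega)
    refine ⟨c, u.take s₁, u.drop s₁ ++ c :: v, ?_, ?_, hc, ?_, ?_⟩
    · rw [← List.append_assoc, List.take_append_drop]
    · exact (h.mono h₁ h₁').sublist ((List.take_sublist _ _).trans (List.sublist_append_left _ _))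
    · simp
      omega
    · simp
      omega

/-- Words cut into blocks of distinct letters from `1, …, 2p + 1`, where the first block avoids
the least and the last block avoids the greatest letter. -/
inductive BlockWord (p : ℕ) : List ℕ → Prop
  | single {b : List ℕ} : IsBlock 2 (2 * p) b → BlockWord p b
  | cut {f e : List ℕ} {ms : List (List ℕ)} : IsBlock 2 (2 * p + 1) f → p ≤ f.length →
      (∀ b ∈ ms, IsBlock 1 (2 * p + 1) b ∧ p + 1 ≤ b.length) →
      IsBlock 1 (2 * p) e → p ≤ e.length → BlockWord p (f ++ (ms.flatten ++ e))

lemma exists_of_flatten_eq_append {ms : List (List ℕ)} {u v : List ℕ}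
    (h : ms.flatten = u ++ v) (hu : u ≠ []) :
    ∃ m₁ b₁ b₂ m₂, ms = m₁ ++ (b₁ ++ b₂) :: m₂ ∧ u = m₁.flatten ++ b₁ ∧ v = b₂ ++ m₂.flatten := by
  induction ms generalizing u with
  | nil => simp_all
  | cons b ms ih =>
    rw [List.flatten_cons, List.append_eq_append_iff] at h
    rcases h with ⟨z, rfl, hz⟩ | ⟨z, rfl, rfl⟩
    · rcases eq_or_ne z [] with rfl | hzn
      · exact ⟨[], b, [], ms, by simp, by simp, by simpa using hz.symm⟩
      · obtain ⟨m₁, b₁, b₂, m₂, rfl, rfl, rfl⟩ := ih hz hzn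
        exact ⟨b :: m₁, b₁, b₂, m₂, by simp, by simp, rfl⟩
    · exact ⟨[], u, z, ms, by simp, by simp, rfl⟩

lemma BlockWord.exists_insert {p : ℕ} (hp : 1 ≤ p) {u v : List ℕ} (h : BlockWord p (u ++ v)) :
    ∃ c, BlockWord p (u ++ c :: v) := by
  generalize hw : u ++ v = w at h
  cases h with
  | single hb =>
    subst hw
    rcases lt_or_ge (u ++ v).length (2 * p + 1 - 2) with hlt | hge
    · obtain ⟨c, hc⟩ := hb.exists_insert hlt
      exact ⟨c, .single hc⟩
    · have hle : (u ++ v).length ≤ 2 * p + 1 - 2 := hb.length_le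
      obtain ⟨c, y, z, e, hy, hz, hly, hlz⟩ := hb.exists_split (lo₁ := 2) (hi₁ := 2 * p + 1)
        (lo₂ := 1) (hi₂ := 2 * p) (s₁ := p) (s₂ := p) (by omega) le_rfl (by omega) (by omega)
        le_rfl (by omega) (by omega)
      refine ⟨c, ?_⟩
      rw [e]
      simpa using BlockWord.cut (ms := []) hy hly.ge (by simp) hz hlz.ge
  | @cut f e ms hf hfl hms he hel =>
    have inFirst : ∀ f₁ f₂, f = f₁ ++ f₂ →
        ∃ c, BlockWord p (f₁ ++ c :: (f₂ ++ (ms.flatten ++ e))) := by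
      rintro f₁ f₂ rfl
      rcases lt_or_ge (f₁ ++ f₂).length (2 * p + 1 + 1 - 2) with hlt | hge
      · obtain ⟨c, hc⟩ := hf.exists_insert hlt
        refine ⟨c, ?_⟩
        have := BlockWord.cut hc (by simp at hfl ⊢; omega) hms he hel
        simpa using this
      · have hle : (f₁ ++ f₂).length ≤ 2 * p + 1 + 1 - 2 := hf.length_le
        obtain ⟨c, y, z, e', hy, hz, hly, hlz⟩ := hf.exists_split (lo₁ := 2) (hi₁ := 2 * p + 1)
          (lo₂ := 1) (hi₂ := 2 * p + 1) (s₁ := p) (s₂ := p + 1) (by omega) le_rfl le_rfl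
          (by omega) le_rfl (by omega) (by omega)
        refine ⟨c, ?_⟩
        have := BlockWord.cut (ms := z :: ms) hy hly.ge (by
          simp only [List.mem_cons, forall_eq_or_imp]
          exact ⟨⟨hz, hlz.ge⟩, hms⟩) he hel
        rw [show f₁ ++ c :: (f₂ ++ (ms.flatten ++ e)) = (f₁ ++ c :: f₂) ++ (ms.flatten ++ e) by
          simp, e']
        simpa using this
    have inLast : ∀ e₁ e₂, e = e₁ ++ e₂ →
        ∃ c, BlockWord p (f ++ (ms.flatten ++ (e₁ ++ c :: e₂))) := by
      rintro e₁ e₂ rfl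
      rcases lt_or_ge (e₁ ++ e₂).length (2 * p + 1 - 1) with hlt | hge
      · obtain ⟨c, hc⟩ := he.exists_insert hlt
        exact ⟨c, BlockWord.cut hf hfl hms hc (by simp at hel ⊢; omega)⟩
      · have hle : (e₁ ++ e₂).length ≤ 2 * p + 1 - 1 := he.length_le
        obtain ⟨c, y, z, e', hy, hz, hly, hlz⟩ := he.exists_split (lo₁ := 1) (hi₁ := 2 * p + 1)
          (lo₂ := 1) (hi₂ := 2 * p) (s₁ := p + 1) (s₂ := p) (by omega) le_rfl (by omega)
          le_rfl le_rfl (by omega) (by omega)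
        refine ⟨c, ?_⟩
        have := BlockWord.cut (ms := ms ++ [y]) hf hfl (by
          intro b hb
          rcases List.mem_append.1 hb with hb | hb
          · exact hms b hb
          · rw [List.mem_singleton] at hb
            subst hb
            exact ⟨hy, hly.ge⟩) hz hlz.ge
        rw [e']
        simpa using this
    have inMid : ∀ m₁ b₁ b₂ m₂, ms = m₁ ++ (b₁ ++ b₂) :: m₂ →
        ∃ c, BlockWord p (f ++ ((m₁.flatten ++ (b₁ ++ c :: b₂) ++ m₂.flatten) ++ e)) := by
      rintro m₁ b₁ b₂ m₂ rfl
      simp only [List.mem_append, List.mem_cons] at hms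
      obtain ⟨hb, hbl⟩ := hms (b₁ ++ b₂) (by simp)
      rcases lt_or_ge (b₁ ++ b₂).length (2 * p + 1 + 1 - 1) with hlt | hge
      · obtain ⟨c, hc⟩ := hb.exists_insert hlt
        refine ⟨c, ?_⟩
        have := BlockWord.cut (ms := m₁ ++ (b₁ ++ c :: b₂) :: m₂) hf hfl (by
          intro b hb
          simp only [List.mem_append, List.mem_cons] at hb
          rcases hb with hb | rfl | hb
          · exact hms b (Or.inl hb)
          · exact ⟨hc, by simp at hbl ⊢; omega⟩
          · exact hms b (Or.inr (Or.inr hb))) he hel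
        simpa using this
      · have hle : (b₁ ++ b₂).length ≤ 2 * p + 1 + 1 - 1 := hb.length_le
        obtain ⟨c, y, z, e', hy, hz, hly, hlz⟩ := hb.exists_split (lo₁ := 1) (hi₁ := 2 * p + 1)
          (lo₂ := 1) (hi₂ := 2 * p + 1) (s₁ := p + 1) (s₂ := p + 1) (by omega) le_rfl le_rfl
          le_rfl le_rfl (by omega) (by omega)
        refine ⟨c, ?_⟩
        have := BlockWord.cut (ms := m₁ ++ y :: z :: m₂) hf hfl (by
          intro b hb
          simp only [List.mem_append, List.mem_cons] at hb
          rcases hb with hb | rfl | rfl | hb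
          · exact hms b (Or.inl hb)
          · exact ⟨hy, hly.ge⟩
          · exact ⟨hz, hlz.ge⟩
          · exact hms b (Or.inr (Or.inr hb))) he hel
        rw [e']
        simpa using this
    rcases List.append_eq_append_iff.1 hw with ⟨z, rfl, rfl⟩ | ⟨z, rfl, hz⟩
    · exact inFirst u z rfl
    · rcases List.append_eq_append_iff.1 hz with ⟨y, rfl, rfl⟩ | ⟨y, hy, rfl⟩
      · obtain ⟨c, hc⟩ := inLast y v rfl
        exact ⟨c, by simpa using hc⟩
      · rcases eq_or_ne z [] with rfl | hzn
        · obtain ⟨c, hc⟩ := inFirst f [] (by simp)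
          refine ⟨c, ?_⟩
          simp only [List.nil_append] at hy
          subst hy
          simpa using hc
        · obtain ⟨m₁, b₁, b₂, m₂, rfl, rfl, rfl⟩ := exists_of_flatten_eq_append hy hzn
          obtain ⟨c, hc⟩ := inMid m₁ b₁ b₂ m₂ rfl
          exact ⟨c, by simpa using hc⟩

/-- A word in which every letter carries the index of its block: block indices are nondecreasing,
letters with the same block index are distinct. -/
def IsTagged (T : List (ℕ × ℕ)) : Prop :=
  T.Pairwise fun x y => x.1 < y.1 ∨ x.1 = y.1 ∧ x.2 ≠ y.2

/-- The letter bounds for a tagged word with `B` blocks over `1, …, q`, where the first block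
avoids the least and the last block avoids the greatest letter. -/
def TagBounds (B q : ℕ) (T : List (ℕ × ℕ)) : Prop :=
  ∀ x ∈ T, (1 ≤ x.1 ∧ x.1 ≤ B) ∧ (1 ≤ x.2 ∧ x.2 ≤ q) ∧ 3 ≤ x.1 + x.2 ∧ x.1 + x.2 + 1 ≤ B + q

/-- Consecutive blocks, tagged by consecutive indices starting from `i`. -/
def tagBlocks : ℕ → List (List ℕ) → List (ℕ × ℕ)
  | _, [] => []
  | i, b :: bs => b.map (fun c => (i, c)) ++ tagBlocks (i + 1) bs

lemma map_snd_tagBlocks (i : ℕ) (bs : List (List ℕ)) :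
    (tagBlocks i bs).map Prod.snd = bs.flatten := by
  induction bs generalizing i with
  | nil => rfl
  | cons b bs ih => simp [tagBlocks, ih, Function.comp_def]

lemma exists_getElem_of_mem_tagBlocks {i : ℕ} {bs : List (List ℕ)} {x : ℕ × ℕ}
    (hx : x ∈ tagBlocks i bs) : ∃ j b, bs[j]? = some b ∧ x.1 = i + j ∧ x.2 ∈ b := by
  induction bs generalizing i with
  | nil => simp [tagBlocks] at hx
  | cons b bs ih =>
    rcases List.mem_append.1 hx with hx | hx
    · obtain ⟨c, hc, rfl⟩ := List.mem_map.1 hx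
      exact ⟨0, b, by simp, by simp, hc⟩
    · obtain ⟨j, b', hj, h1, h2⟩ := ih hx
      exact ⟨j + 1, b', by simpa using hj, by omega, h2⟩

lemma isTagged_tagBlocks (i : ℕ) {bs : List (List ℕ)} (h : ∀ b ∈ bs, b.Nodup) :
    IsTagged (tagBlocks i bs) := by
  induction bs generalizing i with
  | nil => exact List.Pairwise.nil
  | cons b bs ih =>
    refine List.pairwise_append.2 ⟨?_, ih (i + 1) fun c hc => h c (List.mem_cons_of_mem _ hc), ?_⟩
    · rw [List.pairwise_map]
      exact (h b List.mem_cons_self).imp fun hab => Or.inr ⟨rfl, hab⟩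
    · intro x hx y hy
      obtain ⟨c, -, rfl⟩ := List.mem_map.1 hx
      obtain ⟨j, -, -, hj, -⟩ := exists_getElem_of_mem_tagBlocks hy
      exact Or.inl (by simp only; omega)

lemma BlockWord.exists_tagged {p : ℕ} {w : List ℕ} (h : BlockWord p w) :
    ∃ B T, w = T.map Prod.snd ∧ IsTagged T ∧ TagBounds B (2 * p + 1) T ∧ 1 ≤ B ∧
      (B = 1 ∨ B * (p + 1) ≤ w.length + 2) := by
  cases h with
  | single hb =>
    refine ⟨1, tagBlocks 1 [w], by simp [map_snd_tagBlocks],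
      isTagged_tagBlocks 1 (by simpa using hb.1), ?_, le_rfl, Or.inl rfl⟩
    intro x hx
    obtain ⟨j, b, hj, h1, h2⟩ := exists_getElem_of_mem_tagBlocks hx
    rcases j with _ | j
    · simp only [List.getElem?_cons_zero, Option.some.injEq] at hj
      subst hj
      have := hb.2 _ h2
      omega
    · simp at hj
  | @cut f e ms hf hfl hms he hel =>
    refine ⟨ms.length + 2, tagBlocks 1 (f :: (ms ++ [e])), by simp [map_snd_tagBlocks],
      isTagged_tagBlocks 1 ?_, ?_, by omega, Or.inr ?_⟩
    · intro b hb
      simp only [List.mem_cons, List.mem_append, List.not_mem_nil, or_false] at hb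
      rcases hb with rfl | hb | rfl
      · exact hf.1
      · exact (hms b hb).1.1
      · exact he.1
    · intro x hx
      obtain ⟨j, b, hj, h1, h2⟩ := exists_getElem_of_mem_tagBlocks hx
      rcases j with _ | j
      · simp only [List.getElem?_cons_zero, Option.some.injEq] at hj
        subst hj
        have := hf.2 _ h2
        omega
      · rw [List.getElem?_cons_succ] at hj
        rcases lt_or_ge j ms.length with hlt | hge
        · rw [List.getElem?_append_left hlt] at hj
          have := (hms b (List.mem_of_getElem? hj)).1.2 _ h2
          omega
        · rw [List.getElem?_append_right hge] at hj
          rcases hd : j - ms.length with _ | d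
          · rw [hd] at hj
            simp only [List.getElem?_cons_zero, Option.some.injEq] at hj
            subst hj
            have := he.2 _ h2
            omega
          · simp [hd] at hj
    · have hsum : ms.length * (p + 1) ≤ ms.flatten.length := by
        rw [List.length_flatten]
        have := List.card_nsmul_le_sum (ms.map List.length) (p + 1) (by
          intro n hn
          obtain ⟨b, hb, rfl⟩ := List.mem_map.1 hn
          exact (hms b hb).2)
        simpa using this
      simp only [List.length_append]
      nlinarith

/-- A nondecreasing subsequence of a tagged word is strictly increasing in the sum of the block
index and the letter. -/
lemma IsTagged.length_le {T S : List (ℕ × ℕ)} {a b : ℕ} (hT : IsTagged T) (hST : S.Sublist T)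
    (hS : (S.map Prod.snd).Pairwise (· ≤ ·)) (hab : ∀ x ∈ S, a ≤ x.1 + x.2 ∧ x.1 + x.2 ≤ b) :
    S.length ≤ b + 1 - a := by
  have hnd : (S.map fun x => x.1 + x.2).Nodup := by
    rw [List.Nodup, List.pairwise_map]
    rw [List.pairwise_map] at hS
    refine ((hT.sublist hST).and hS).imp ?_
    rintro x y ⟨h1, h2⟩
    omega
  rw [← Nat.card_Icc, ← List.length_map (fun x : ℕ × ℕ => x.1 + x.2),
    ← List.toFinset_card_of_nodup hnd]
  refine Finset.card_le_card fun c hc => ?_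
  obtain ⟨x, hx, rfl⟩ := List.mem_map.1 (List.mem_toFinset.1 hc)
  exact Finset.mem_Icc.2 (hab x hx)

/-- The block index at position `i`, and `B` beyond the end of the word. -/
def tagAt (B : ℕ) (T : List (ℕ × ℕ)) (i : ℕ) : ℕ := (T[i]?.map Prod.fst).getD B

lemma IsTagged.monotone_tagAt {B q : ℕ} {T : List (ℕ × ℕ)} (hT : IsTagged T)
    (hB : TagBounds B q T) : Monotone (tagAt B T) := by
  intro i j hij
  rcases hij.eq_or_lt with rfl | hij
  · rfl
  rcases lt_or_ge j T.length with hj | hj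
  · have := List.pairwise_iff_getElem.1 hT i j (by omega) hj hij
    simp only [tagAt, List.getElem?_eq_getElem hj, List.getElem?_eq_getElem (hij.trans hj),
      Option.map_some, Option.getD_some]
    omega
  · rcases lt_or_ge i T.length with hi | hi
    · have := (hB T[i] (List.getElem_mem hi)).1.2
      simpa [tagAt, hi, hj] using this
    · simp [tagAt, hi, hj]

lemma tagAt_le {B q : ℕ} {T : List (ℕ × ℕ)} (hB : TagBounds B q T) (i : ℕ) :
    tagAt B T i ≤ B := by
  rcases lt_or_ge i T.length with hi | hi
  · simpa [tagAt, hi] using (hB T[i] (List.getElem_mem hi)).1.2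
  · simp [tagAt, hi]

lemma IsTagged.exists_savings {B D q : ℕ} {T : List (ℕ × ℕ)} (hT : IsTagged T)
    (hB : TagBounds B q T) (hB1 : 1 ≤ B) (hBD : B ≤ D) (hq : 3 ≤ q) :
    ∃ l r, Savings (D - 3) (T.map Prod.snd).length l r ∧
      WindowBound (D + q - 3) l r (T.map Prod.snd) := by
  have hmono := hT.monotone_tagAt hB
  have hle := tagAt_le hB
  refine ⟨fun i => tagAt B T i - 2 + (D - B), fun j => B - 1 - tagAt B T (T.length - j - 1),
    ⟨?_, ?_, ?_⟩, ?_⟩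
  · intro i j hij
    have := hmono hij
    simp only
    omega
  · intro i j hij
    have := hmono (show T.length - j - 1 ≤ T.length - i - 1 by omega)
    simp only
    omega
  · intro i j hij
    rw [List.length_map] at hij
    have := hmono (show T.length - j - 1 ≤ i by omega)
    have := hle i
    omega
  · intro A Z C s hW hsub hs hne
    obtain ⟨T₁, TC, rfl, h₁, rfl⟩ := List.map_eq_append_iff.1 hW
    obtain ⟨TA, TZ, rfl, rfl, rfl⟩ := List.map_eq_append_iff.1 h₁
    obtain ⟨S, hS, rfl⟩ := List.sublist_map_iff.1 hsub
    have htag : ∀ x ∈ S, tagAt B (TA ++ TZ ++ TC) TA.length ≤ x.1 ∧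
        x.1 ≤ tagAt B (TA ++ TZ ++ TC) ((TA ++ TZ ++ TC).length - TC.length - 1) := by
      intro x hx
      obtain ⟨i, hi, rfl⟩ := List.getElem_of_mem (hS.subset hx)
      have heq : tagAt B (TA ++ TZ ++ TC) (TA.length + i) = TZ[i].1 := by
        simp [tagAt, List.getElem?_append, hi]
      rw [← heq]
      constructor
      · exact hmono (by omega)
      · exact hmono (by simp; omega)
    have hST : S.Sublist (TA ++ TZ ++ TC) :=
      hS.trans ((List.sublist_append_right TA TZ).trans (List.sublist_append_left _ TC))
    have hlen := hT.length_le (a := max 3 (tagAt B (TA ++ TZ ++ TC) TA.length + 1))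
      (b := min (B + q - 1)
        (tagAt B (TA ++ TZ ++ TC) ((TA ++ TZ ++ TC).length - TC.length - 1) + q)) hST hs (by
      intro x hx
      have := hB x (hST.subset hx)
      have := htag x hx
      omega)
    obtain ⟨x, hx⟩ := List.exists_mem_of_ne_nil S (by simpa using hne)
    have h₁ := htag x hx
    have h₂ := hB x (hST.subset hx)
    simp only [List.length_map]
    have := hle TA.length
    have := hle ((TA ++ TZ ++ TC).length - TC.length - 1)
    omega

lemma BlockWord.mem_bounds {p : ℕ} {w : List ℕ} (h : BlockWord p w) :
    ∀ c ∈ w, 1 ≤ c ∧ c ≤ 2 * p + 1 := by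
  obtain ⟨B, T, rfl, -, hB, -⟩ := h.exists_tagged
  intro c hc
  obtain ⟨x, hx, rfl⟩ := List.mem_map.1 hc
  exact (hB x hx).2.1

/-- The invariant for `2p + 3` tiers: an inner game with blocks of at least `p + 1` letters,
followed by moves in two outer tiers. -/
lemma exists_tierInvariant_odd {p D : ℕ} (hp : 1 ≤ p) (hD : 5 ≤ D) :
    ∃ Good, TierInvariant (2 * p + 3) ((p + 1) * (D + 1) - 3 + (D - 3)) (D + 2 * p - 2) Good := by
  refine exists_tierInvariant_of_inner (q := 2 * p + 1) (by omega) (BlockWord p)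
    (.single ⟨by simp, by simp⟩) (fun w hw => hw.mem_bounds)
    (fun u v h _ => h.exists_insert hp) fun w hw hlen => ?_
  obtain ⟨B, T, rfl, hT, hB, hB1, hcard⟩ := hw.exists_tagged
  have hBD : B ≤ D := by
    rcases hcard with rfl | hcard
    · omega
    · have h3 : 3 ≤ (p + 1) * (D + 1) := by nlinarith
      have : B * (p + 1) < (D + 1) * (p + 1) := by
        rw [mul_comm (D + 1)]
        omega
      exact Nat.lt_succ_iff.1 (lt_of_mul_lt_mul_right this (Nat.zero_le _))
  obtain ⟨l, r, hs, hb⟩ := hT.exists_savings hB hB1 hBD (show 3 ≤ 2 * p + 1 by omega)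
  exact ⟨l, r, hs, by rwa [show D + 2 * p - 2 = D + (2 * p + 1) - 3 by omega]⟩

/-- The invariant for `2t - 1` tiers. -/
lemma exists_tierInvariant {t D : ℕ} (ht : 2 ≤ t) (hD : 5 ≤ D) :
    ∃ N Good, t * D - 4 ≤ N ∧ TierInvariant (2 * t - 1) N (D + 2 * t - 6) Good := by
  rcases ht.eq_or_lt with rfl | ht
  · obtain ⟨Good, h⟩ := exists_tierInvariant_three (D - 2)
    exact ⟨D - 2 + (D - 2), Good, by omega, by rwa [show D + 2 * 2 - 6 = D - 2 by omega]⟩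
  · obtain ⟨p, rfl⟩ : ∃ p, t = p + 2 := ⟨t - 2, by omega⟩
    obtain ⟨Good, h⟩ := exists_tierInvariant_odd (p := p) (by omega) hD
    refine ⟨(p + 1) * (D + 1) - 3 + (D - 3), Good, ?_, ?_⟩
    · have e₁ : (p + 2) * D = p * D + 2 * D := by ring
      have e₂ : (p + 1) * (D + 1) = p * D + p + D + 1 := by ring
      rw [e₁, e₂]
      omega
    · rwa [show 2 * (p + 2) - 1 = 2 * p + 3 by omega,
        show D + 2 * (p + 2) - 6 = D + 2 * p - 2 by omega]

/-- The tier of the height `y` when the unit interval is cut into `K` equal tiers. -/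
noncomputable def tier (K : ℕ) (y : ℝ) : ℕ := ⌊(K : ℝ) * y⌋₊

lemma monotone_tier (K : ℕ) : Monotone (tier K) := fun _ _ h =>
  Nat.floor_mono (mul_le_mul_of_nonneg_left h (Nat.cast_nonneg K))

lemma tier_lt {K : ℕ} (hK : 0 < K) {y : ℝ} (h₀ : 0 ≤ y) (h₁ : y < 1) : tier K y < K := by
  have hK' : (0 : ℝ) < K := Nat.cast_pos.2 hK
  rw [tier, Nat.floor_lt (by positivity)]
  nlinarith

/-- The points listed from left to right are increasing within each tier, and no point lies on
the lower boundary of its tier. -/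
structure TierIncreasing (K : ℕ) (l : List Pt) : Prop where
  pairwise : l.Pairwise fun p q => p.1 < q.1 ∧ (tier K p.2 = tier K q.2 → p.2 < q.2)
  bounds : ∀ p ∈ l, p.2 ∈ Ioo (0 : ℝ) 1 ∧ (tier K p.2 : ℝ) < K * p.2

/-- The played points, read from left to right, are increasing within each tier and form a good
word of tiers. -/
def GoodPosition (K : ℕ) (Good : List ℕ → Prop) (h : List Pt) : Prop :=
  ∃ l : List Pt, l.Perm h ∧ TierIncreasing K l ∧ Good (l.map fun p => tier K p.2)

lemma exists_split_at {l : List Pt} {x : ℝ} (hl : l.Pairwise fun p q => p.1 < q.1)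
    (hx : ∀ p ∈ l, x ≠ p.1) :
    ∃ u v, l = u ++ v ∧ (∀ p ∈ u, p.1 < x) ∧ ∀ p ∈ v, x < p.1 := by
  induction l with
  | nil => exact ⟨[], [], rfl, by simp, by simp⟩
  | cons a l ih =>
    rw [List.pairwise_cons] at hl
    rcases lt_or_gt_of_ne (hx a List.mem_cons_self) with h | h
    · refine ⟨[], a :: l, rfl, by simp, ?_⟩
      simp only [List.mem_cons, forall_eq_or_imp]
      exact ⟨h, fun p hp => h.trans (hl.1 p hp)⟩
    · obtain ⟨u, v, rfl, hu, hv⟩ := ih hl.2 fun p hp => hx p (List.mem_cons_of_mem _ hp)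
      refine ⟨a :: u, v, rfl, ?_, hv⟩
      simp only [List.mem_cons, forall_eq_or_imp]
      exact ⟨h, hu⟩

lemma exists_between_finsets_notMem (lo hi F : Finset ℝ) (h : ∀ x ∈ lo, ∀ y ∈ hi, x < y) :
    ∃ m ∉ F, (∀ x ∈ lo, x < m) ∧ ∀ y ∈ hi, m < y := by
  obtain ⟨a, ha, ha'⟩ := Order.exists_between_finsets lo hi h
  obtain ⟨b, hb, hb'⟩ := Order.exists_between_finsets {a} hi (by simpa using ha')
  obtain ⟨m, hm, hmF⟩ := (Ioo_infinite (hb a (by simp))).exists_notMem_finset F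
  exact ⟨m, hmF, fun x hx => (ha x hx).trans hm.1, fun y hy => hm.2.trans (hb' y hy)⟩

/-- A new point can be placed in any tier between the points to its left and to its right. -/
lemma TierIncreasing.exists_height {K c : ℕ} (hc : c < K) {u v : List Pt}
    (h : TierIncreasing K (u ++ v)) (F : Finset ℝ) :
    ∃ y ∉ F, y ∈ Ioo (0 : ℝ) 1 ∧ tier K y = c ∧ (c : ℝ) < K * y ∧
      (∀ p ∈ u, tier K p.2 = c → p.2 < y) ∧ ∀ p ∈ v, tier K p.2 = c → y < p.2 := by
  have hK : (0 : ℝ) < K := Nat.cast_pos.2 (by omega)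
  have hup : ∀ p ∈ u ++ v, tier K p.2 = c → p.2 < (c + 1) / K := by
    rintro p - rfl
    rw [lt_div_iff₀ hK, mul_comm]
    exact Nat.lt_floor_add_one _
  have hdown : ∀ p ∈ u ++ v, tier K p.2 = c → (c : ℝ) / K < p.2 := by
    rintro p hp rfl
    rw [div_lt_iff₀ hK, mul_comm]
    exact (h.bounds p hp).2
  obtain ⟨y, hyF, hlo, hhi⟩ := exists_between_finsets_notMem
    (insert ((c : ℝ) / K) ((u.filter fun p => tier K p.2 = c).map Prod.snd).toFinset)
    (insert (((c : ℝ) + 1) / K) ((v.filter fun p => tier K p.2 = c).map Prod.snd).toFinset) F (by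
      simp only [Finset.mem_insert, List.mem_toFinset, List.mem_map, List.mem_filter,
        decide_eq_true_eq]
      rintro a (rfl | ⟨p, ⟨hp, hpc⟩, rfl⟩) b (rfl | ⟨p', ⟨hp', hpc'⟩, rfl⟩)
      · gcongr
        linarith
      · exact hdown p' (List.mem_append_right _ hp') hpc'
      · exact hup p (List.mem_append_left _ hp) hpc
      · exact ((List.pairwise_append.1 h.pairwise).2.2 p hp p' hp').2 (hpc.trans hpc'.symm))
  simp only [Finset.mem_insert, List.mem_toFinset, List.mem_map, List.mem_filter,
    decide_eq_true_eq, forall_eq_or_imp, forall_exists_index, and_imp] at hlo hhi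
  have h₁ : (c : ℝ) < K * y := by
    have := hlo.1
    rwa [div_lt_iff₀ hK, mul_comm] at this
  have h₂ : K * y < (c : ℝ) + 1 := by
    have := hhi.1
    rwa [lt_div_iff₀ hK, mul_comm] at this
  have hcK : (c : ℝ) + 1 ≤ K := by exact_mod_cast hc
  have hc0 : (0 : ℝ) ≤ c := Nat.cast_nonneg c
  have hy0 : 0 < y := by
    by_contra! hle
    nlinarith
  have hy1 : y < 1 := by
    by_contra! hle
    nlinarith
  refine ⟨y, hyF, ⟨hy0, hy1⟩, ?_, h₁, fun p hp hpc => hlo.2 _ p hp hpc rfl,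
    fun p hp hpc => hhi.2 _ p hp hpc rfl⟩
  rw [tier, Nat.floor_eq_iff (by positivity)]
  exact ⟨h₁.le, h₂⟩

lemma GoodPosition.exists_extension {K N M : ℕ} {Good : List ℕ → Prop}
    (hG : TierInvariant K N M Good) {h : List Pt} (hh : GoodPosition K Good h)
    (hlen : h.length < N) {x : ℝ} (hx : ∀ p ∈ h, x ≠ p.1) :
    ∃ y ∈ Ioo (0 : ℝ) 1, (∀ p ∈ h, y ≠ p.2) ∧ GoodPosition K Good (h ++ [(x, y)]) := by
  obtain ⟨l, hperm, hl, hgood⟩ := hh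
  obtain ⟨u, v, rfl, hu, hv⟩ := exists_split_at (hl.pairwise.imp And.left)
    fun p hp => hx p (hperm.mem_iff.1 hp)
  rw [List.map_append] at hgood
  obtain ⟨c, hc, hgood'⟩ := hG.exists_insert _ _ hgood (by
    rw [← List.map_append, List.length_map, hperm.length_eq]
    exact hlen)
  obtain ⟨y, hyF, hy, rfl, hyc, hyu, hyv⟩ := hl.exists_height hc (h.map Prod.snd).toFinset
  have hperm' : (u ++ (x, y) :: v).Perm ((x, y) :: (u ++ v)) := List.perm_middle
  refine ⟨y, hy, ?_, u ++ (x, y) :: v, ?_, ⟨?_, ?_⟩, by simpa using hgood'⟩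
  · rintro p hp rfl
    exact hyF (by simpa using ⟨p.1, hp⟩)
  · exact hperm'.trans ((hperm.cons _).trans (List.perm_append_singleton _ _).symm)
  · obtain ⟨h₁, h₂, h₃⟩ := List.pairwise_append.1 hl.pairwise
    refine List.pairwise_append.2 ⟨h₁, List.pairwise_cons.2
      ⟨fun p hp => ⟨hv p hp, fun e => hyv p hp e.symm⟩, h₂⟩, fun p hp q hq => ?_⟩
    rcases List.mem_cons.1 hq with rfl | hq
    · exact ⟨hu p hp, hyu p hp⟩
    · exact h₃ p hp q hq
  · intro p hp
    rcases List.mem_cons.1 (hperm'.mem_iff.1 hp) with rfl | hp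
    · exact ⟨hy, hyc⟩
    · exact hl.bounds p hp

lemma exists_mem_Ioo_forall_ne (l : List ℝ) : ∃ y ∈ Ioo (0 : ℝ) 1, ∀ z ∈ l, y ≠ z := by
  obtain ⟨y, hy, hyl⟩ := (Ioo_infinite (zero_lt_one' ℝ)).exists_notMem_finset l.toFinset
  exact ⟨y, hy, fun z hz e => hyl (List.mem_toFinset.2 (e ▸ hz))⟩

lemma length_hist (sA : AStrat) (sB : BStrat) (n : ℕ) : (hist sA sB n).length = n := by
  induction n with
  | zero => rfl
  | succ n ih => simp [hist, ih]

/-- A tier invariant yields a valid strategy for player B that keeps the position good. -/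
lemma TierInvariant.exists_strategy {K N M : ℕ} {Good : List ℕ → Prop}
    (hG : TierInvariant K N M Good) :
    ∃ sB : BStrat, BValid sB ∧ ∀ sA : AStrat, AValid sA → ∀ n ≤ N,
      GoodPosition K Good (hist sA sB n) := by
  have key : ∀ (h : List Pt) (x : ℝ), ∃ y, (y ∈ Ioo (0 : ℝ) 1 ∧ ∀ p ∈ h, y ≠ p.2) ∧
      (GoodPosition K Good h → h.length < N → (∀ p ∈ h, x ≠ p.1) →
        GoodPosition K Good (h ++ [(x, y)])) := by
    intro h x
    by_cases hc : GoodPosition K Good h ∧ h.length < N ∧ ∀ p ∈ h, x ≠ p.1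
    · obtain ⟨y, hy, hyh, hg⟩ := hc.1.exists_extension hG hc.2.1 hc.2.2
      exact ⟨y, ⟨hy, hyh⟩, fun _ _ _ => hg⟩
    · obtain ⟨y, hy, hyh⟩ := exists_mem_Ioo_forall_ne (h.map Prod.snd)
      exact ⟨y, ⟨hy, fun p hp => hyh p.2 (List.mem_map_of_mem hp)⟩,
        fun h₁ h₂ h₃ => absurd ⟨h₁, h₂, h₃⟩ hc⟩
  choose sB hvalid hgood using key
  refine ⟨sB, hvalid, fun sA hA n => ?_⟩
  induction n with
  | zero => exact fun _ => ⟨[], .refl _, ⟨.nil, by simp⟩, hG.nil⟩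
  | succ n ih =>
    intro hn
    exact hgood _ _ (ih (by omega)) (by rw [length_hist]; omega) (hA _).2

lemma TierIncreasing.not_hasDownRun {K : ℕ} (hK : 0 < K) {l : List Pt}
    (hl : TierIncreasing K l) : ¬ HasDownRun {p | p ∈ l} (K + 1) := by
  rintro ⟨f, hf, hx, hy⟩
  obtain ⟨i, j, hne, heq⟩ := Fintype.exists_ne_map_eq_of_card_lt
    (fun i => (⟨tier K (f i).2, tier_lt hK (hl.bounds _ (hf i)).1.1.le
      (hl.bounds _ (hf i)).1.2⟩ : Fin K)) (by simp)
  simp only [Fin.mk.injEq] at heq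
  have main : ∀ i j, i < j → tier K (f i).2 = tier K (f j).2 → False := by
    intro i j hij heq
    obtain ⟨a, ha, hai⟩ := List.getElem_of_mem (hf i)
    obtain ⟨b, hb, hbj⟩ := List.getElem_of_mem (hf j)
    have h₁ := hx hij
    have h₂ := hy hij
    simp only at h₁ h₂
    rcases lt_trichotomy a b with h | h | h
    · have := (List.pairwise_iff_getElem.1 hl.pairwise a b ha hb h).2
      rw [hai, hbj] at this
      exact lt_asymm h₂ (this heq)
    · subst h
      rw [← hai, ← hbj] at h₁
      exact lt_irrefl _ h₁
    · have := (List.pairwise_iff_getElem.1 hl.pairwise b a hb ha h).1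
      rw [hai, hbj] at this
      exact lt_asymm h₁ this
  rcases lt_or_gt_of_ne hne with h | h
  · exact main i j h heq
  · exact main j i h heq.symm

lemma GoodPosition.not_hasDownRun {K : ℕ} {Good : List ℕ → Prop} (hK : 0 < K) {h : List Pt}
    (hh : GoodPosition K Good h) : ¬ HasDownRun {p | p ∈ h} (K + 1) := by
  obtain ⟨l, hperm, hl, -⟩ := hh
  simpa only [hperm.mem_iff] using hl.not_hasDownRun hK

lemma GoodPosition.not_hasUpRun {K N M : ℕ} {Good : List ℕ → Prop}
    (hG : TierInvariant K N M Good) {h : List Pt} (hh : GoodPosition K Good h)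
    (hlen : h.length ≤ N) : ¬ HasUpRun {p | p ∈ h} (M + 1) := by
  obtain ⟨l, hperm, hl, hgood⟩ := hh
  rintro ⟨f, hf, hx, hy⟩
  have : Std.Antisymm fun p q : Pt => p.1 < q.1 := ⟨fun _ _ h₁ h₂ => absurd h₂ h₁.asymm⟩
  have hpf : (List.ofFn f).Pairwise fun p q => p.1 < q.1 :=
    List.pairwise_ofFn.2 fun _ _ hij => hx hij
  have hsub : (List.ofFn f).Sublist l := by
    refine List.sublist_of_subperm_of_pairwise (List.subperm_of_subset ?_ ?_) hpf
      (hl.pairwise.imp And.left)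
    · exact hpf.imp fun hpq e => by simp [e] at hpq
    · intro p hp
      obtain ⟨i, rfl⟩ := List.mem_ofFn.1 hp
      exact hperm.mem_iff.2 (hf i)
  have := hG.length_le _ _ hgood (by rw [List.length_map, hperm.length_eq]; exact hlen)
    (hsub.map _) (List.pairwise_map.2
      (List.pairwise_ofFn.2 fun _ _ hij => monotone_tier K (hy hij.le)))
  simp at this

/-- A weak form of the Erdős–Szekeres theorem for lists of points. -/
lemma exists_sublist_monotone_or_antitone (n : ℕ) : ∀ (a b : ℕ) (l : List Pt), a + b ≤ n →
    2 ^ n ≤ l.length →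
    (∃ s : List Pt, s.Sublist l ∧ s.length = a ∧ s.Pairwise fun p q => p.2 ≤ q.2) ∨
      ∃ s : List Pt, s.Sublist l ∧ s.length = b ∧ s.Pairwise fun p q => q.2 < p.2 := by
  induction n with
  | zero =>
    intro a b l hab _
    exact Or.inl ⟨[], List.nil_sublist _, by simp; omega, .nil⟩
  | succ n ih =>
    intro a b l hab hl
    rcases Nat.eq_zero_or_pos a with rfl | ha
    · exact Or.inl ⟨[], List.nil_sublist _, rfl, .nil⟩
    rcases Nat.eq_zero_or_pos b with rfl | hb
    · exact Or.inr ⟨[], List.nil_sublist _, rfl, .nil⟩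
    cases l with
    | nil => simp at hl
    | cons x l =>
      have hsum := l.length_eq_length_filter_add fun p => decide (x.2 ≤ p.2)
      rw [pow_succ, List.length_cons] at hl
      rcases le_or_gt (2 ^ n) (l.filter fun p => decide (x.2 ≤ p.2)).length with h | h
      · rcases ih (a - 1) b _ (by omega) h with ⟨s, hs, hsl, hsp⟩ | ⟨s, hs, hsl, hsp⟩
        · refine Or.inl ⟨x :: s, (hs.trans List.filter_sublist).cons_cons x, by simp; omega,
            List.pairwise_cons.2 ⟨fun p hp => ?_, hsp⟩⟩
          simpa using (List.mem_filter.1 (hs.subset hp)).2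
        · exact Or.inr ⟨s, (hs.trans List.filter_sublist).cons x, hsl, hsp⟩
      · rcases ih a (b - 1) (l.filter fun p => !decide (x.2 ≤ p.2)) (by omega) (by omega) with
          ⟨s, hs, hsl, hsp⟩ | ⟨s, hs, hsl, hsp⟩
        · exact Or.inl ⟨s, (hs.trans List.filter_sublist).cons x, hsl, hsp⟩
        · refine Or.inr ⟨x :: s, (hs.trans List.filter_sublist).cons_cons x, by simp; omega,
            List.pairwise_cons.2 ⟨fun p hp => ?_, hsp⟩⟩
          simpa using (List.mem_filter.1 (hs.subset hp)).2

lemma nodup_map_fst_hist {sA : AStrat} (hA : AValid sA) (sB : BStrat) (n : ℕ) :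
    ((hist sA sB n).map Prod.fst).Nodup := by
  induction n with
  | zero => simp [hist]
  | succ n ih =>
    simp only [hist, List.map_append, List.map_cons, List.map_nil]
    refine List.nodup_append.2 ⟨ih, List.nodup_singleton _, fun a ha b hb => ?_⟩
    obtain ⟨p, hp, rfl⟩ := List.mem_map.1 ha
    rw [List.mem_singleton.1 hb]
    exact ((hA _).2 p hp).symm

lemma exists_aValid : ∃ sA : AStrat, AValid sA := by
  choose sA hA using fun h : List Pt => exists_mem_Ioo_forall_ne (h.map Prod.fst)
  exact ⟨sA, fun h => ⟨(hA h).1, fun p hp => (hA h).2 p.1 (List.mem_map_of_mem hp)⟩⟩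

lemma exists_aWinsBy (m k : ℕ) : ∃ N, ∃ sA : AStrat, AWinsBy m k N sA := by
  obtain ⟨sA, hA⟩ := exists_aValid
  refine ⟨2 ^ (m + k), sA, hA, fun sB _ => ?_⟩
  set h := hist sA sB (2 ^ (m + k)) with hh
  set l := h.mergeSort (fun p q => decide (p.1 ≤ q.1)) with hl
  have hperm : l.Perm h := List.mergeSort_perm _ _
  have hle : l.Pairwise fun p q => p.1 ≤ q.1 := by
    have := List.pairwise_mergeSort (le := fun p q : Pt => decide (p.1 ≤ q.1))
      (fun a b c => by simpa using le_trans) (fun a b => by simpa using le_total a.1 b.1) h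
    simpa using this
  have hlt : l.Pairwise fun p q => p.1 < q.1 := by
    have hnd : (l.map Prod.fst).Nodup :=
      (hperm.map Prod.fst).nodup_iff.2 (nodup_map_fst_hist hA sB _)
    rw [List.Nodup, List.pairwise_map] at hnd
    exact (hle.and hnd).imp fun hpq => lt_of_le_of_ne hpq.1 hpq.2
  have hmem : ∀ {s : List Pt}, s.Sublist l → ∀ p ∈ s, p ∈ played sA sB (2 ^ (m + k)) :=
    fun hs p hp => hperm.mem_iff.1 (hs.subset hp)
  rcases exists_sublist_monotone_or_antitone (m + k) m k l le_rfl
      (by rw [hperm.length_eq, hh, length_hist]) with ⟨s, hs, rfl, hsp⟩ | ⟨s, hs, rfl, hsp⟩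
  · refine Or.inl ⟨s.get, fun i => hmem hs _ (List.get_mem s i),
      fun i j hij => List.pairwise_iff_get.1 (hlt.sublist hs) i j hij, fun i j hij => ?_⟩
    rcases hij.eq_or_lt with rfl | hij
    · exact le_rfl
    · exact List.pairwise_iff_get.1 hsp i j hij
  · exact Or.inr ⟨s.get, fun i => hmem hs _ (List.get_mem s i),
      fun i j hij => List.pairwise_iff_get.1 (hlt.sublist hs) i j hij,
      fun i j hij => List.pairwise_iff_get.1 hsp i j hij⟩

lemma played_mono (sA : AStrat) (sB : BStrat) : Monotone (played sA sB) :=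
  monotone_nat_of_le_succ fun _ _ hp => List.mem_append_left _ hp

lemma HasUpRun.mono {P Q : Set Pt} {n : ℕ} (h : HasUpRun P n) (hPQ : P ⊆ Q) : HasUpRun Q n :=
  let ⟨f, hf, hx, hy⟩ := h
  ⟨f, fun i => hPQ (hf i), hx, hy⟩

lemma HasDownRun.mono {P Q : Set Pt} {n : ℕ} (h : HasDownRun P n) (hPQ : P ⊆ Q) :
    HasDownRun Q n :=
  let ⟨f, hf, hx, hy⟩ := h
  ⟨f, fun i => hPQ (hf i), hx, hy⟩

lemma HasDownRun.of_le {P : Set Pt} {n n' : ℕ} (h : HasDownRun P n) (hn : n' ≤ n) :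
    HasDownRun P n' :=
  let ⟨f, hf, hx, hy⟩ := h
  ⟨f ∘ Fin.castLE hn, fun _ => hf _, hx.comp (Fin.strictMono_castLE hn),
    hy.comp_strictMono (Fin.strictMono_castLE hn)⟩

lemma le_ESO_of_strategy {m k N : ℕ} (sB : BStrat) (hB : BValid sB)
    (h : ∀ sA, AValid sA → ¬ HasUpRun (played sA sB N) m ∧ ¬ HasDownRun (played sA sB N) k) :
    N + 1 ≤ ESO m k := by
  obtain ⟨sA, hA, hwin⟩ : ∃ sA, AWinsBy m k (ESO m k) sA := Nat.sInf_mem (exists_aWinsBy m k)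
  by_contra! hlt
  have hsub := played_mono sA sB (show ESO m k ≤ N by omega)
  rcases hwin sB hB with h' | h'
  · exact (h sA hA).1 (h'.mono hsub)
  · exact (h sA hA).2 (h'.mono hsub)

theorem ESO_general_lower_bound (m k : ℕ) (hk : 4 ≤ k) (hkm : k ≤ m) :
    k / 2 * (m - k + 5) - 3 ≤ ESO m k ∧
    ∃ sB : BStrat, BValid sB ∧ ∀ sA : AStrat, AValid sA →
      ¬ HasUpRun (played sA sB (k / 2 * (m - k + 5) - 4)) m ∧
      ¬ HasDownRun (played sA sB (k / 2 * (m - k + 5) - 4)) k := by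
  suffices hmain : ∃ sB : BStrat, BValid sB ∧ ∀ sA : AStrat, AValid sA →
      ¬ HasUpRun (played sA sB (k / 2 * (m - k + 5) - 4)) m ∧
      ¬ HasDownRun (played sA sB (k / 2 * (m - k + 5) - 4)) k by
    refine ⟨?_, hmain⟩
    obtain ⟨sB, hB, h⟩ := hmain
    have := le_ESO_of_strategy sB hB h
    omega
  obtain ⟨N, Good, hN, hG⟩ := exists_tierInvariant (t := k / 2) (D := m - 2 * (k / 2) + 5)
    (by omega) (by omega)
  have hle : k / 2 * (m - k + 5) - 4 ≤ N := by
    have : k / 2 * (m - k + 5) ≤ k / 2 * (m - 2 * (k / 2) + 5) :=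
      Nat.mul_le_mul_left _ (by omega)
    omega
  obtain ⟨sB, hB, hgood⟩ := hG.exists_strategy
  refine ⟨sB, hB, fun sA hA => ⟨fun h => ?_, fun h => ?_⟩⟩
  · refine (hgood sA hA _ hle).not_hasUpRun hG (by rwa [length_hist]) ?_
    rwa [show m - 2 * (k / 2) + 5 + 2 * (k / 2) - 6 + 1 = m by omega]
  · exact (hgood sA hA _ hle).not_hasDownRun (by omega) (h.of_le (by omega))
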